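/- arXiv:1703.02177 — 2 statements merged into one kernel-verified Lean document; each statement's English description precedes it below -/
import Mathlib

section
/- Let W and U be independent random variables on a probability space, where W has the generalized inverse Gaussian distribution GIG(λ, χ, ψ) on (0, ∞) and U has the multivariate Gaussian distribution N(0, Σ) on ℝ^p with Σ positive definite. Let μ, β ∈ ℝ^p and X = μ + W·β + √W·U. Partition X = (X₁ᵀ, X₂ᵀ)ᵀ, μ = (μ₁ᵀ, μ₂ᵀ)ᵀ, β = (β₁ᵀ, β₂ᵀ)ᵀ into the first d₁ and last d₂ = p − d₁ coordinates, and partition Σ conformably with upper-left d₁×d₁ block Σ₁₁. Then the law of X₁ equals the law of μ₁ + W'·β₁ + √(W')·U₁, where W' ∼ GIG(λ, χ, ψ) and U₁ ∼ N(0, Σ₁₁) are independent; that is, the marginal distribution of X₁ is the generalized hyperbolic distribution GHD_{d₁}(λ, ω, μ₁, Σ₁₁, β₁), with the mixing distribution parameters λ and ω unchanged. -/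
open MeasureTheory ProbabilityTheory Matrix

/-- The multivariate Gaussian distribution `N(m, S)` on `ι → ℝ`, defined via its
Lebesgue density. -/
noncomputable def mvGaussian {ι : Type*} [Fintype ι] [DecidableEq ι]
    (m : ι → ℝ) (S : Matrix ι ι ℝ) : Measure (ι → ℝ) :=
  volume.withDensity fun x =>
    ENNReal.ofReal ((2 * Real.pi) ^ (-(Fintype.card ι : ℝ) / 2) * S.det ^ (-(1 : ℝ) / 2) *
      Real.exp (-((x - m) ⬝ᵥ (S⁻¹ *ᵥ (x - m))) / 2))

/-- The generalized inverse Gaussian distribution `GIG(λ, χ, ψ)` on `(0, ∞)`,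
defined via its Lebesgue density `w ↦ w^(λ-1) exp(-(ψw + χ/w)/2) / I(λ, χ, ψ)`. -/
noncomputable def gigMeasure (lam χ ψ : ℝ) : Measure ℝ :=
  volume.withDensity fun w =>
    Set.indicator (Set.Ioi (0 : ℝ))
      (fun w => ENNReal.ofReal (w ^ (lam - 1) * Real.exp (-(ψ * w + χ / w) / 2) /
        ∫ v in Set.Ioi (0 : ℝ), v ^ (lam - 1) * Real.exp (-(ψ * v + χ / v) / 2))) w

/-- The Lebesgue density of the multivariate Gaussian distribution `N(m, S)`. -/
noncomputable def mvGaussianPDF {ι : Type*} [Fintype ι] [DecidableEq ι]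
    (m : ι → ℝ) (S : Matrix ι ι ℝ) (x : ι → ℝ) : ℝ :=
  (2 * Real.pi) ^ (-(Fintype.card ι : ℝ) / 2) * S.det ^ (-(1 : ℝ) / 2) *
    Real.exp (-((x - m) ⬝ᵥ (S⁻¹ *ᵥ (x - m))) / 2)

section Density

variable {ι κ : Type*} [Fintype ι] [Fintype κ]

lemma lintegral_exp_neg_dotProduct_self_div_two :
    ∫⁻ x : ι → ℝ, ENNReal.ofReal (Real.exp (-(x ⬝ᵥ x) / 2)) =
      ENNReal.ofReal ((2 * Real.pi) ^ ((Fintype.card ι : ℝ) / 2)) := by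
  have hnorm (v : EuclideanSpace ℝ ι) :
      Real.exp (-(v.ofLp ⬝ᵥ v.ofLp) / 2) = Real.exp (-(1 / 2) * ‖v‖ ^ 2) := by
    rw [EuclideanSpace.real_norm_sq_eq]
    simp only [dotProduct, ← sq]
    ring_nf
  have hint := GaussianFourier.integral_rexp_neg_mul_sq_norm
    (V := EuclideanSpace ℝ ι) (b := 1 / 2) (by norm_num)
  have hpos : 0 < (Real.pi / (1 / 2)) ^
      ((Module.finrank ℝ (EuclideanSpace ℝ ι) : ℝ) / 2) := by positivity
  rw [← (PiLp.volume_preserving_ofLp ι).lintegral_comp (by fun_prop)]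
  simp_rw [hnorm]
  rw [← ofReal_integral_eq_lintegral_ofReal
    (.of_integral_ne_zero (hint ▸ hpos.ne')) (.of_forall fun _ => (Real.exp_pos _).le), hint,
    finrank_euclideanSpace]
  congr 3
  ring

variable [DecidableEq ι] [DecidableEq κ]

lemma mvGaussian_eq_withDensity (m : ι → ℝ) (S : Matrix ι ι ℝ) :
    mvGaussian m S = volume.withDensity fun x => ENNReal.ofReal (mvGaussianPDF m S x) := rfl

lemma mvGaussianPDF_nonneg (m : ι → ℝ) {S : Matrix ι ι ℝ} (hS : S.PosDef) (x : ι → ℝ) :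
    0 ≤ mvGaussianPDF m S x := by
  have := hS.det_pos
  unfold mvGaussianPDF
  positivity

lemma measurable_mvGaussianPDF (m : ι → ℝ) (S : Matrix ι ι ℝ) :
    Measurable (mvGaussianPDF m S) := by
  unfold mvGaussianPDF
  refine Continuous.measurable ?_
  fun_prop

lemma lintegral_mvGaussianPDF_zero {S : Matrix ι ι ℝ} (hS : S.PosDef) :
    ∫⁻ x, ENNReal.ofReal (mvGaussianPDF 0 S x) = 1 := by
  obtain ⟨B, hB⟩ : ∃ B : Matrix ι ι ℝ, S⁻¹ = Bᵀ * B := by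
    open scoped MatrixOrder in
    obtain ⟨B, hB⟩ := CStarAlgebra.nonneg_iff_eq_star_mul_self.mp hS.inv.posSemidef.nonneg
    exact ⟨B, by simpa [star_eq_conjTranspose] using hB⟩
  have hdet : S.det⁻¹ = B.det ^ 2 := by
    rw [← Ring.inverse_eq_inv', ← det_nonsing_inv, hB, det_mul, det_transpose, sq]
  have hSdet := hS.det_pos
  have hBdet : B.det ≠ 0 := by
    intro h
    simp [h, hSdet.ne'] at hdet
  have hpdf (x : ι → ℝ) : ENNReal.ofReal (mvGaussianPDF 0 S x) =
      ENNReal.ofReal ((2 * Real.pi) ^ (-(Fintype.card ι : ℝ) / 2) * |B.det|) *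
        ENNReal.ofReal (Real.exp (-(toLin' B x ⬝ᵥ toLin' B x) / 2)) := by
    rw [← ENNReal.ofReal_mul (by positivity), mvGaussianPDF, sub_zero, hB]
    congr 3
    · rw [neg_div, Real.rpow_neg hSdet.le, ← Real.inv_rpow hSdet.le, hdet, ← Real.sqrt_eq_rpow,
        Real.sqrt_sq_eq_abs]
    · rw [toLin'_apply, ← mulVec_mulVec, dotProduct_mulVec, vecMul_transpose]
  simp_rw [hpdf]
  have hexp : Measurable fun y : ι → ℝ => ENNReal.ofReal (Real.exp (-(y ⬝ᵥ y) / 2)) :=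
    (Continuous.measurable (by fun_prop)).ennreal_ofReal
  have hB_meas : Measurable (toLin' B) := (toLin' B).continuous_of_finiteDimensional.measurable
  rw [lintegral_const_mul _ (by exact hexp.comp hB_meas), ← lintegral_map hexp hB_meas,
    Real.map_matrix_volume_pi_eq_smul_volume_pi hBdet, lintegral_smul_measure,
    lintegral_exp_neg_dotProduct_self_div_two, smul_eq_mul, ← ENNReal.ofReal_mul (by positivity),
    ← ENNReal.ofReal_mul (by positivity), ENNReal.ofReal_eq_one, neg_div,
    Real.rpow_neg (by positivity), abs_inv]
  field_simp

lemma exists_mvGaussianPDF_sumElim_eq_mul {S : Matrix (ι ⊕ κ) (ι ⊕ κ) ℝ} (hS : S.PosDef) :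
    ∃ (C : Matrix κ ι ℝ) (D : Matrix κ κ ℝ), D.PosDef ∧ ∀ a b,
      mvGaussianPDF 0 S (Sum.elim a b) =
        mvGaussianPDF 0 (S.submatrix Sum.inl Sum.inl) a * mvGaussianPDF 0 D (C *ᵥ a + b) := by
  set A := S⁻¹.toBlocks₁₁
  set B := S⁻¹.toBlocks₁₂
  set R := S⁻¹.toBlocks₂₂ with hR
  have hRpos : R.PosDef := hS.inv.submatrix Sum.inr_injective
  have hblocks : S⁻¹ = fromBlocks A B Bᴴ R := by
    have h := hS.inv.isHermitian
    rw [← fromBlocks_toBlocks S⁻¹, isHermitian_fromBlocks_iff] at h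
    rw [h.2.1, fromBlocks_toBlocks]
  have hSpos := hS.det_pos
  let : Invertible R := hRpos.isUnit.invertible
  let : Invertible (fromBlocks A B Bᴴ R) := (hblocks ▸ hS.inv).isUnit.invertible
  let : Invertible (A - B * ⅟R * Bᴴ) := invertibleOfFromBlocks₂₂Invertible A B Bᴴ R
  have hschur : (S.submatrix Sum.inl Sum.inl)⁻¹ = A - B * R⁻¹ * Bᴴ := by
    have h : S = ⅟(fromBlocks A B Bᴴ R) := by
      rw [invOf_eq_nonsing_inv, ← hblocks, nonsing_inv_nonsing_inv _ hSpos.ne'.isUnit]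
    rw [h, invOf_fromBlocks₂₂_eq, ← invOf_eq_nonsing_inv R]
    change (⅟(A - B * ⅟R * Bᴴ))⁻¹ = _
    rw [← invOf_eq_nonsing_inv, invOf_invOf]
  have hSpos₁ : (S.submatrix Sum.inl Sum.inl).PosDef := hS.submatrix Sum.inl_injective
  have hdet : S.det = (S.submatrix Sum.inl Sum.inl).det * R⁻¹.det := by
    have h := det_fromBlocks₂₂ A B Bᴴ R
    rw [← hblocks, invOf_eq_nonsing_inv, ← hschur] at h
    simp only [det_nonsing_inv, Ring.inverse_eq_inv'] at h ⊢
    rw [← _root_.inv_inj, h, mul_inv, inv_inv, mul_comm]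
  refine ⟨R⁻¹ * Bᴴ, R⁻¹, hRpos.inv, fun a b => ?_⟩
  have hquad := schur_complement_eq₂₂ A B (D := R) a b hRpos.isHermitian
  rw [← hblocks, ← hschur] at hquad
  simp only [star_trivial, ← dotProduct_mulVec] at hquad
  have hdet₁ := hSpos₁.det_pos
  have hdet₂ := hRpos.inv.det_pos
  simp only [mvGaussianPDF, sub_zero, hquad, hdet, Real.mul_rpow hdet₁.le hdet₂.le,
    nonsing_inv_nonsing_inv _ hRpos.det_pos.ne'.isUnit, neg_add, add_div, Real.exp_add,
    Fintype.card_sum, Nat.cast_add, Real.rpow_add Real.two_pi_pos]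
  ring

/-- The first block of a centred Gaussian vector with covariance matrix `S` is Gaussian, with
covariance matrix the corresponding diagonal block of `S`. -/
lemma map_comp_inl_mvGaussian {S : Matrix (ι ⊕ κ) (ι ⊕ κ) ℝ} (hS : S.PosDef) :
    (mvGaussian 0 S).map (fun x i => x (Sum.inl i)) =
      mvGaussian 0 (S.submatrix Sum.inl Sum.inl) := by
  obtain ⟨C, D, hD, hpdf⟩ := exists_mvGaussianPDF_sumElim_eq_mul hS
  have hS₁ : (S.submatrix Sum.inl Sum.inl).PosDef := hS.submatrix Sum.inl_injective
  have hmeas : Measurable fun (x : ι ⊕ κ → ℝ) (i : ι) => x (Sum.inl i) := by fun_prop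
  refine Measure.ext_of_lintegral _ fun f hf => ?_
  have hpdfS := (measurable_mvGaussianPDF 0 S).ennreal_ofReal
  have hpdfD := (measurable_mvGaussianPDF 0 D).ennreal_ofReal
  have hpdf₁ := (measurable_mvGaussianPDF 0 (S.submatrix Sum.inl Sum.inl)).ennreal_ofReal
  rw [lintegral_map hf hmeas, mvGaussian_eq_withDensity, mvGaussian_eq_withDensity,
    lintegral_withDensity_eq_lintegral_mul _ hpdfS
      (g := fun x => f fun i => x (Sum.inl i)) (by exact hf.comp hmeas),
    lintegral_withDensity_eq_lintegral_mul _ hpdf₁ hf,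
    ← (volume_measurePreserving_sumPiEquivProdPi_symm (fun _ : ι ⊕ κ => ℝ)).lintegral_comp
      (by exact hpdfS.mul (hf.comp hmeas))]
  have hsymm (p : (ι → ℝ) × (κ → ℝ)) :
      (MeasurableEquiv.sumPiEquivProdPi fun _ : ι ⊕ κ => ℝ).symm p = Sum.elim p.1 p.2 := by
    ext (i | i) <;> rfl
  simp_rw [hsymm]
  simp only [Pi.mul_apply, hpdf, Sum.elim_inl, ENNReal.ofReal_mul (mvGaussianPDF_nonneg 0 hS₁ _)]
  rw [Measure.volume_eq_prod, lintegral_prod]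
  · refine lintegral_congr fun a => ?_
    simp_rw [mul_right_comm _ _ (f a)]
    rw [lintegral_const_mul _ (by exact hpdfD.comp (measurable_const_add (C *ᵥ a))),
      lintegral_add_left_eq_self (fun b => ENNReal.ofReal (mvGaussianPDF 0 D b)),
      lintegral_mvGaussianPDF_zero hD, mul_one]
  · refine Measurable.aemeasurable (((hpdf₁.comp measurable_fst).mul (hpdfD.comp ?_)).mul
      (hf.comp measurable_fst))
    exact Continuous.measurable (by fun_prop)

end Density

/-- Marginalization of the generalized hyperbolic distribution: if
`X = μ + Wβ + √W U` on `ℝ^(d₁+d₂)` with `W ∼ GIG(λ, χ, ψ)` and `U ∼ N(0, Σ)`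
independent, then the subvector `X₁` of the first `d₁` coordinates has the law of
`μ₁ + W' β₁ + √W' U₁` with `W' ∼ GIG(λ, χ, ψ)` and `U₁ ∼ N(0, Σ₁₁)` independent,
i.e. `X₁ ∼ GHD_{d₁}(λ, ω, μ₁, Σ₁₁, β₁)` with the mixing distribution unchanged. -/
theorem ghd_marginal {d₁ d₂ : ℕ} {Ω : Type*} [MeasurableSpace Ω]
    (P : Measure Ω) [IsProbabilityMeasure P]
    (lam χ ψ : ℝ) (hχ : 0 < χ) (hψ : 0 < ψ)
    (S : Matrix (Fin d₁ ⊕ Fin d₂) (Fin d₁ ⊕ Fin d₂) ℝ) (hS : S.PosDef)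
    (W : Ω → ℝ) (U : Ω → (Fin d₁ ⊕ Fin d₂ → ℝ)) (hW : Measurable W) (hU : Measurable U)
    (hlawW : Measure.map W P = gigMeasure lam χ ψ)
    (hlawU : Measure.map U P = mvGaussian 0 S)
    (hindep : IndepFun W U P)
    (μ β : Fin d₁ ⊕ Fin d₂ → ℝ) (X : Ω → (Fin d₁ ⊕ Fin d₂ → ℝ))
    (hX : X = fun ω => μ + W ω • β + Real.sqrt (W ω) • U ω) :
    Measure.map (fun ω => fun i : Fin d₁ => X ω (Sum.inl i)) P =
      Measure.map
        (fun q : ℝ × (Fin d₁ → ℝ) =>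
          (μ ∘ Sum.inl) + q.1 • (β ∘ Sum.inl) + Real.sqrt q.1 • q.2)
        ((gigMeasure lam χ ψ).prod (mvGaussian 0 (S.submatrix Sum.inl Sum.inl))) := by
  have hsub : Measurable fun (x : Fin d₁ ⊕ Fin d₂ → ℝ) (i : Fin d₁) => x (Sum.inl i) := by
    fun_prop
  have hprod := (hindep.comp measurable_id hsub).map_prod_eq_prod_map_map
    hW.aemeasurable (hsub.comp hU).aemeasurable
  rw [← Measure.map_map hsub hU, hlawU, map_comp_inl_mvGaussian hS] at hprod
  rw [← hlawW, ← hprod, Measure.map_map (by fun_prop) (hW.prodMk (hsub.comp hU)), hX]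
  rfl
end

section
/- Let W and U be independent random variables on a probability space, where W has the inverse Gamma distribution IG(v/2, v/2) on (0, ∞) with v > 0 and U has the multivariate Gaussian distribution N(0, Σ) on ℝ^p with Σ positive definite. Let μ, β ∈ ℝ^p and X = μ + W·β + √W·U, so that X follows the multivariate skew-t distribution ST_p(v, μ, Σ, β). Let B be a k×p real matrix such that B Σ Bᵀ is positive definite, and let b ∈ ℝ^k. Then the law of B X + b equals the law of (B μ + b) + W'·(B β) + √(W')·U', where W' ∼ IG(v/2, v/2) and U' ∼ N(0, B Σ Bᵀ) are independent; that is, B X + b ∼ ST_k(v, Bμ + b, BΣBᵀ, Bβ). -/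
open MeasureTheory ProbabilityTheory Matrix

/-- The inverse Gamma distribution `IG(a, b)` on `(0, ∞)`, defined via its Lebesgue
density `w ↦ (b^a / Γ(a)) w^(-a-1) exp(-b/w)`. -/
noncomputable def invGammaMeasure (a b : ℝ) : Measure ℝ :=
  volume.withDensity fun w =>
    Set.indicator (Set.Ioi (0 : ℝ))
      (fun w => ENNReal.ofReal (b ^ a / Real.Gamma a * w ^ (-a - 1) * Real.exp (-b / w))) w

lemma measurable_mvGaussian_density {ι : Type*} [Fintype ι] (c : ℝ) (M : Matrix ι ι ℝ) :
    Measurable fun x : ι → ℝ => ENNReal.ofReal (c * Real.exp (-(x ⬝ᵥ (M *ᵥ x)) / 2)) := by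
  have : Measurable fun x : ι → ℝ => x ⬝ᵥ (M *ᵥ x) := by
    unfold Matrix.mulVec dotProduct
    fun_prop
  fun_prop

lemma mvGaussian_zero_one {ι : Type*} [Fintype ι] [DecidableEq ι] :
    mvGaussian (0 : ι → ℝ) 1 = Measure.pi fun _ => gaussianReal 0 1 := by
  have hdens (x : ι → ℝ) : (2 * Real.pi) ^ (-(Fintype.card ι : ℝ) / 2) *
      (1 : Matrix ι ι ℝ).det ^ (-(1 : ℝ) / 2) *
      Real.exp (-((x - 0) ⬝ᵥ ((1 : Matrix ι ι ℝ)⁻¹ *ᵥ (x - 0))) / 2) =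
      ∏ i, gaussianPDFReal 0 1 (x i) := by
    have hpi : (0 : ℝ) ≤ 2 * Real.pi := by positivity
    simp only [gaussianPDFReal, Finset.prod_mul_distrib, Finset.prod_const, Finset.card_univ,
      ← Real.exp_sum, dotProduct]
    simp only [NNReal.coe_one, mul_one, sub_zero, det_one, Real.one_rpow, inv_one, one_mulVec]
    rw [← Finset.sum_div, Finset.sum_neg_distrib, Real.sqrt_eq_rpow, ← Real.rpow_neg hpi,
      ← Real.rpow_natCast, ← Real.rpow_mul hpi]
    simp only [pow_two]
    ring_nf
  refine (Measure.pi_eq fun s hs => ?_).symm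
  have hint : Integrable (fun x : ι → ℝ => ∏ i, gaussianPDFReal 0 1 (x i))
      (Measure.pi fun i => volume.restrict (s i)) :=
    Integrable.fintype_prod fun i => (integrable_gaussianPDFReal 0 1).restrict
  rw [mvGaussian, withDensity_apply _ (.univ_pi hs)]
  simp_rw [hdens]
  rw [volume_pi, Measure.restrict_pi_pi, ← ofReal_integral_eq_lintegral_ofReal hint
      (ae_of_all _ fun x => Finset.prod_nonneg fun i _ => gaussianPDFReal_nonneg 0 1 (x i)),
    integral_fintype_prod_eq_prod (fun _ x => gaussianPDFReal 0 1 x),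
    ENNReal.ofReal_prod_of_nonneg fun i _ => integral_nonneg (gaussianPDFReal_nonneg 0 1)]
  simp_rw [gaussianReal_apply_eq_integral 0 one_ne_zero]

lemma map_withDensity_comp {α β : Type*} [MeasurableSpace α] [MeasurableSpace β]
    (ν : Measure α) {f : α → β} (hf : Measurable f) {g : β → ENNReal} (hg : Measurable g) :
    (ν.withDensity (g ∘ f)).map f = (ν.map f).withDensity g := by
  ext s hs
  rw [Measure.map_apply hf hs, withDensity_apply _ (hf hs), withDensity_apply _ hs,
    setLIntegral_map hs hg hf]
  rfl

lemma map_mulVec_mvGaussian_zero_one {ι : Type*} [Fintype ι] [DecidableEq ι]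
    (A : Matrix ι ι ℝ) (hA : A.det ≠ 0) :
    (mvGaussian 0 1).map (fun x => A *ᵥ x) = mvGaussian 0 (A * Aᵀ) := by
  have hunit : IsUnit A.det := hA.isUnit
  have hquad (x : ι → ℝ) : (A *ᵥ x) ⬝ᵥ ((A * Aᵀ)⁻¹ *ᵥ (A *ᵥ x)) = x ⬝ᵥ x := by
    rw [Matrix.mul_inv_rev, mulVec_mulVec, Matrix.mul_assoc, nonsing_inv_mul _ hunit, Matrix.mul_one,
      dotProduct_mulVec, ← mulVec_transpose, mulVec_mulVec, transpose_nonsing_inv,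
      transpose_transpose, nonsing_inv_mul _ hunit, one_mulVec]
  set c : ℝ := (2 * Real.pi) ^ (-(Fintype.card ι : ℝ) / 2)
  have hg := measurable_mvGaussian_density c (A * Aᵀ)⁻¹
  have hmeas : Measurable fun x : ι → ℝ => A *ᵥ x := by fun_prop
  have hone : mvGaussian (0 : ι → ℝ) 1 = volume.withDensity
      ((fun y => ENNReal.ofReal (c * Real.exp (-(y ⬝ᵥ ((A * Aᵀ)⁻¹ *ᵥ y)) / 2))) ∘
        fun x => A *ᵥ x) := by
    simp only [Function.comp_def, hquad]
    simp [mvGaussian, c]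
  have hdet : (A * Aᵀ).det ^ (-(1 : ℝ) / 2) = |A.det⁻¹| := by
    rw [det_mul, det_transpose, ← pow_two, ← sq_abs, ← Real.rpow_natCast,
      ← Real.rpow_mul (abs_nonneg _), abs_inv, ← Real.rpow_neg_one]
    norm_num
  have hvol : (volume : Measure (ι → ℝ)).map (fun x => A *ᵥ x) =
      ENNReal.ofReal |A.det⁻¹| • volume := Real.map_matrix_volume_pi_eq_smul_volume_pi hA
  rw [hone, map_withDensity_comp _ hmeas hg, hvol, withDensity_smul_measure,
    ← withDensity_smul _ hg, mvGaussian]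
  congr 1 with y
  simp only [Pi.smul_apply, smul_eq_mul, sub_zero]
  rw [hdet, ← ENNReal.ofReal_mul (abs_nonneg _)]
  congr 1
  ring

open scoped MatrixOrder in
lemma map_toLp_mvGaussian {ι : Type*} [Fintype ι] [DecidableEq ι]
    {S : Matrix ι ι ℝ} (hS : S.PosDef) :
    (mvGaussian 0 S).map (WithLp.toLp 2) = multivariateGaussian 0 S := by
  set A := CFC.sqrt S
  have hAA : A * A = S := CFC.sqrt_mul_sqrt_self S hS.posSemidef.nonneg
  have hAt : Aᵀ = A := by
    have h : star A = A := (CFC.sqrt_nonneg S).isSelfAdjoint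
    rwa [star_eq_conjTranspose, conjTranspose_eq_transpose_of_trivial] at h
  have hdet : A.det ≠ 0 := by
    intro h
    have := hS.det_pos
    rw [← hAA, det_mul, h, mul_zero] at this
    exact this.false
  have hS' : A * Aᵀ = S := by rw [hAt, hAA]
  rw [← hS', ← map_mulVec_mvGaussian_zero_one A hdet, hS', mvGaussian_zero_one,
    multivariateGaussian, ← map_pi_eq_stdGaussian, Measure.map_map (by fun_prop) (by fun_prop),
    Measure.map_map (by fun_prop) (by fun_prop)]
  congr 1 with x
  simp [A]

lemma map_mulVec_mvGaussian {ι κ : Type*} [Fintype ι] [DecidableEq ι] [Fintype κ]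
    [DecidableEq κ] {S : Matrix ι ι ℝ} (hS : S.PosDef) (B : Matrix κ ι ℝ)
    (hBSB : (B * S * Bᵀ).PosDef) :
    (mvGaussian 0 S).map (fun x => B *ᵥ x) = mvGaussian 0 (B * S * Bᵀ) := by
  have hinj : (mvGaussian 0 S).map (fun x => WithLp.toLp 2 (B *ᵥ x)) =
      (mvGaussian 0 (B * S * Bᵀ)).map (WithLp.toLp 2) := by
    have hcomp : (fun x : ι → ℝ => WithLp.toLp 2 (B *ᵥ x)) =
        (fun y : EuclideanSpace ℝ ι => WithLp.toLp 2 (B *ᵥ WithLp.ofLp y)) ∘ WithLp.toLp 2 := rfl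
    rw [hcomp, ← Measure.map_map (by fun_prop) (by fun_prop), map_toLp_mvGaussian hS,
      map_toLp_mvGaussian hBSB]
    apply Measure.ext_of_charFun (E := EuclideanSpace ℝ κ)
    ext t
    have hadj : charFun ((multivariateGaussian 0 S).map
        fun y : EuclideanSpace ℝ ι => WithLp.toLp 2 (B *ᵥ WithLp.ofLp y)) t =
        charFun (multivariateGaussian 0 S) (WithLp.toLp 2 (Bᵀ *ᵥ WithLp.ofLp t)) := by
      rw [charFun_apply, charFun_apply, integral_map (by fun_prop) (by fun_prop)]
      congr with y
      simp [EuclideanSpace.inner_eq_star_dotProduct, dotProduct_mulVec, mulVec_transpose]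
    rw [hadj, charFun_multivariateGaussian hS.posSemidef,
      charFun_multivariateGaussian hBSB.posSemidef]
    simp only [inner_zero_right]
    rw [← mulVec_mulVec, ← mulVec_mulVec, dotProduct_mulVec _ B, ← mulVec_transpose]
  have h := congrArg (Measure.map (WithLp.ofLp : EuclideanSpace ℝ κ → κ → ℝ)) hinj
  rw [Measure.map_map (by fun_prop) (by fun_prop),
    Measure.map_map (by fun_prop) (by fun_prop)] at h
  simpa [Function.comp_def] using h

/-- Closure of the multivariate skew-t distribution under affine transformations:
if `X = μ + Wβ + √W U ∼ ST_p(v, μ, Σ, β)` with `W ∼ IG(v/2, v/2)` and `U ∼ N(0, Σ)`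
independent, then `BX + b ∼ ST_k(v, Bμ + b, BΣBᵀ, Bβ)`, i.e. `BX + b` has the law of
`(Bμ + b) + W'(Bβ) + √W' U'` with `W' ∼ IG(v/2, v/2)` and `U' ∼ N(0, BΣBᵀ)`
independent. -/
theorem skewt_affine_transformation {p k : ℕ} {Ω : Type*} [MeasurableSpace Ω]
    (P : Measure Ω) [IsProbabilityMeasure P]
    (v : ℝ) (hv : 0 < v)
    (S : Matrix (Fin p) (Fin p) ℝ) (hS : S.PosDef)
    (W : Ω → ℝ) (U : Ω → (Fin p → ℝ)) (hW : Measurable W) (hU : Measurable U)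
    (hlawW : Measure.map W P = invGammaMeasure (v / 2) (v / 2))
    (hlawU : Measure.map U P = mvGaussian 0 S)
    (hindep : IndepFun W U P)
    (μ β : Fin p → ℝ) (X : Ω → (Fin p → ℝ))
    (hX : X = fun ω => μ + W ω • β + Real.sqrt (W ω) • U ω)
    (B : Matrix (Fin k) (Fin p) ℝ) (b : Fin k → ℝ)
    (hBSB : (B * S * Bᵀ).PosDef) :
    Measure.map (fun ω => B *ᵥ X ω + b) P =
      Measure.map
        (fun q : ℝ × (Fin k → ℝ) =>
          (B *ᵥ μ + b) + q.1 • (B *ᵥ β) + Real.sqrt q.1 • q.2)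
        ((invGammaMeasure (v / 2) (v / 2)).prod (mvGaussian 0 (B * S * Bᵀ))) := by
  have hWU : P.map (fun ω => (W ω, U ω)) =
      (invGammaMeasure (v / 2) (v / 2)).prod (mvGaussian 0 S) := by
    rw [← hlawW, ← hlawU]
    exact (indepFun_iff_map_prod_eq_prod_map_map hW.aemeasurable hU.aemeasurable).1 hindep
  have : IsProbabilityMeasure (invGammaMeasure (v / 2) (v / 2)) :=
    hlawW ▸ Measure.isProbabilityMeasure_map hW.aemeasurable
  have : IsProbabilityMeasure (mvGaussian 0 S) :=
    hlawU ▸ Measure.isProbabilityMeasure_map hU.aemeasurable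
  have hprod := Measure.map_prod_map (invGammaMeasure (v / 2) (v / 2)) (mvGaussian 0 S)
    measurable_id (show Measurable fun x : Fin p → ℝ => B *ᵥ x by fun_prop)
  rw [Measure.map_id, map_mulVec_mvGaussian hS B hBSB, ← hWU] at hprod
  rw [hprod, Measure.map_map (by fun_prop) (by fun_prop), Measure.map_map (by fun_prop)
    (by fun_prop)]
  congr 1 with ω
  simp only [hX, Function.comp_apply, Prod.map_apply, id_eq, mulVec_add, mulVec_smul]
  simp only [Pi.add_apply]
  ring
end
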